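/- Andrews' identity for the sums of three squares: (∑_{n=−∞}^{∞} (−1)^n q^{n²})³ = 1 + 4 ∑_{n=1}^∞ (−1)^n q^n / (1 + q^n) − 2 ∑_{n=1}^∞ [(1 − q^n)/(1 + q^n)] ∑_{|j|<n} (−1)^j q^{n² − j²}, where the inner sum runs over integers j with −n < j < n. -/

import Mathlib

open scoped BigOperators

/-- The finite q-shifted factorial `(a; q)_n`. -/
noncomputable def qPoch (q a : ℂ) (n : ℕ) : ℂ :=
  ∏ k ∈ Finset.range n, (1 - a * q ^ k)

/-- The infinite q-shifted factorial `(a; q)_∞`. -/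
noncomputable def qPochInf (q a : ℂ) : ℂ :=
  ∏' k : ℕ, (1 - a * q ^ k)

/-- The `n`-th term of the basic hypergeometric series `₃φ₂`.
(For `₃φ₂` the factor `((-1)^n q^(n(n-1)/2))^(1+s-r)` is `1`.) -/
noncomputable def phi32term (q a₁ a₂ a₃ b₁ b₂ z : ℂ) (n : ℕ) : ℂ :=
  qPoch q a₁ n * qPoch q a₂ n * qPoch q a₃ n /
    (qPoch q q n * qPoch q b₁ n * qPoch q b₂ n) * z ^ n

/-- The basic hypergeometric series `₃φ₂(a₁,a₂,a₃; b₁,b₂; q, z)`. -/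
noncomputable def phi32 (q a₁ a₂ a₃ b₁ b₂ z : ℂ) : ℂ :=
  ∑' n : ℕ, phi32term q a₁ a₂ a₃ b₁ b₂ z n

/-- The `n`-th term of the basic hypergeometric series `₄φ₃`. -/
noncomputable def phi43term (q a₁ a₂ a₃ a₄ b₁ b₂ b₃ z : ℂ) (n : ℕ) : ℂ :=
  qPoch q a₁ n * qPoch q a₂ n * qPoch q a₃ n * qPoch q a₄ n /
    (qPoch q q n * qPoch q b₁ n * qPoch q b₂ n * qPoch q b₃ n) * z ^ n

/-- The basic hypergeometric series `₄φ₃(a₁,a₂,a₃,a₄; b₁,b₂,b₃; q, z)`. -/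
noncomputable def phi43 (q a₁ a₂ a₃ a₄ b₁ b₂ b₃ z : ℂ) : ℂ :=
  ∑' n : ℕ, phi43term q a₁ a₂ a₃ a₄ b₁ b₂ b₃ z n

open Finset Filter Topology

/-- `1 / (q; q)_m`, extended by zero to negative `m`. -/
noncomputable def invPoch (q : ℂ) (m : ℤ) : ℂ :=
  if m < 0 then 0 else (qPoch q q m.toNat)⁻¹

/-- The weight of `|j|` in a sum over the integers `j`. -/
def absWeight (j : ℕ) : ℂ := if j = 0 then 1 else 2

/-- The partial theta sum over the integers `j` with `|j| < r`, in base `1 / q`. -/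
noncomputable def thetaInvPartial (q : ℂ) (r : ℕ) : ℂ :=
  ∑ j ∈ range r, absWeight j * (-1) ^ j * (q ^ (j ^ 2))⁻¹

lemma qPoch_succ (q a : ℂ) (n : ℕ) : qPoch q a (n + 1) = qPoch q a n * (1 - a * q ^ n) :=
  prod_range_succ _ _

lemma one_sub_pow_succ_ne_zero {q : ℂ} (hq : ‖q‖ < 1) (n : ℕ) : 1 - q ^ (n + 1) ≠ 0 := by
  intro h
  have h1 : ‖q ^ (n + 1)‖ < 1 := by
    rw [norm_pow]; exact pow_lt_one₀ (norm_nonneg _) hq (by omega)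
  rw [← sub_eq_zero.mp h] at h1
  simp at h1

lemma one_add_pow_ne_zero {q : ℂ} (hq : ‖q‖ < 1) (n : ℕ) : 1 + q ^ n ≠ 0 := by
  rcases n with _ | n
  · norm_num
  intro h
  have h1 : ‖q ^ (n + 1)‖ < 1 := by
    rw [norm_pow]; exact pow_lt_one₀ (norm_nonneg _) hq (by omega)
  rw [← neg_eq_of_add_eq_zero_right h] at h1
  simp at h1

lemma qPoch_self_ne_zero {q : ℂ} (hq : ‖q‖ < 1) (n : ℕ) : qPoch q q n ≠ 0 := by
  refine prod_ne_zero_iff.mpr fun k _ => ?_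
  rw [← pow_succ']
  exact one_sub_pow_succ_ne_zero hq k

lemma qPoch_neg_ne_zero {q : ℂ} (hq : ‖q‖ < 1) (n : ℕ) : qPoch q (-q) n ≠ 0 := by
  refine prod_ne_zero_iff.mpr fun k _ => ?_
  rw [neg_mul, sub_neg_eq_add, ← pow_succ']
  exact one_add_pow_ne_zero hq (k + 1)

lemma invPoch_natCast (q : ℂ) (n : ℕ) : invPoch q n = (qPoch q q n)⁻¹ := by
  simp [invPoch]

lemma invPoch_zero (q : ℂ) : invPoch q 0 = 1 := by
  simp [invPoch, qPoch]

lemma invPoch_of_neg (q : ℂ) {m : ℤ} (hm : m < 0) : invPoch q m = 0 := by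
  simp [invPoch, hm]

lemma invPoch_sub_one {q : ℂ} (hq : ‖q‖ < 1) (m : ℤ) :
    invPoch q (m - 1) = (1 - q ^ m) * invPoch q m := by
  rcases lt_trichotomy m 0 with h | rfl | h
  · rw [invPoch_of_neg q h, invPoch_of_neg q (by omega), mul_zero]
  · rw [invPoch_of_neg q (by omega)]; simp
  · obtain ⟨n, rfl⟩ : ∃ n : ℕ, m = (n : ℤ) + 1 := ⟨(m - 1).toNat, by omega⟩
    have h2 : ((n : ℤ) + 1) = ((n + 1 : ℕ) : ℤ) := by push_cast; ring
    rw [add_sub_cancel_right, h2, invPoch_natCast, invPoch_natCast, zpow_natCast, qPoch_succ,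
      ← pow_succ']
    have := qPoch_self_ne_zero hq n
    have := one_sub_pow_succ_ne_zero hq n
    field_simp

lemma pow_choose_two_succ (q : ℂ) (n : ℕ) :
    q ^ (n + 1).choose 2 = q ^ n.choose 2 * q ^ n := by
  rw [← pow_add, Nat.choose_succ_succ' n 1, Nat.choose_one_right, add_comm]

lemma pow_choose_two_mul (q : ℂ) (n : ℕ) :
    q ^ (n + 1).choose 2 * q ^ n.choose 2 = q ^ n ^ 2 := by
  induction n with
  | zero => simp
  | succ n ih =>
    rw [pow_choose_two_succ q (n + 1), show (n + 1) ^ 2 = n ^ 2 + (n + (n + 1)) by ring,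
      pow_add q (n ^ 2), ← ih, pow_choose_two_succ q n]
    ring

/-- The numerators `(-1; q)_n q^(n (n + 1) / 2)` of the Bailey lemma with parameters `-1`, `∞`. -/
noncomputable def baileyWeight (q : ℂ) (n : ℕ) : ℂ :=
  2 * qPoch q (-q) n / (1 + q ^ n) * q ^ (n + 1).choose 2

lemma baileyWeight_succ {q : ℂ} (hq : ‖q‖ < 1) (n : ℕ) :
    baileyWeight q (n + 1) = baileyWeight q n * ((1 + q ^ n) * q ^ (n + 1)) := by
  have h1 := one_add_pow_ne_zero hq n
  have h2 := one_add_pow_ne_zero hq (n + 1)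
  unfold baileyWeight
  rw [pow_choose_two_succ q (n + 1), qPoch_succ, neg_mul, sub_neg_eq_add, ← pow_succ']
  field_simp

/-- A terminating `q`-Chu–Vandermonde summation. -/
lemma sum_baileyWeight {q : ℂ} (hq0 : q ≠ 0) (hq : ‖q‖ < 1) (r N : ℕ) :
    ∑ n ∈ range (N + 1), baileyWeight q n * invPoch q (N - n) * invPoch q (n - r) *
        invPoch q (n + r) =
      qPoch q (-q) N * (2 / (1 + q ^ r) * q ^ (r + 1).choose 2) * invPoch q (N - r) *
        invPoch q (N + r) := by
  rcases lt_or_ge N r with h | h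
  · rw [invPoch_of_neg q (show (N : ℤ) - r < 0 by omega)]
    simp only [mul_zero, zero_mul]
    refine sum_eq_zero fun n hn => ?_
    rw [mem_range] at hn
    rw [invPoch_of_neg q (show (n : ℤ) - r < 0 by omega)]
    simp
  induction N, h using Nat.le_induction with
  | base =>
    rw [sum_range_succ, sum_eq_zero]
    · simp only [sub_self, invPoch_zero, baileyWeight]; ring
    · intro n hn
      rw [mem_range] at hn
      rw [invPoch_of_neg q (show (n : ℤ) - r < 0 by omega)]
      simp
  | succ N hN ih =>
    have key : ∀ n : ℕ,
        (1 - q ^ ((N : ℤ) + 1 - r)) * (1 - q ^ ((N : ℤ) + 1 + r)) *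
          (baileyWeight q n * invPoch q (N + 1 - n) * invPoch q (n - r) * invPoch q (n + r)) -
        (1 + q ^ (N + 1)) *
          (baileyWeight q n * invPoch q (N - n) * invPoch q (n - r) * invPoch q (n + r)) =
        (-q ^ ((N : ℤ) + 1 - (n + 1 : ℕ)) * baileyWeight q (n + 1) *
          invPoch q (N + 1 - (n + 1 : ℕ)) * invPoch q ((n + 1 : ℕ) - 1 - r) *
          invPoch q ((n + 1 : ℕ) - 1 + r)) -
        (-q ^ ((N : ℤ) + 1 - n) * baileyWeight q n * invPoch q (N + 1 - n) *
          invPoch q (n - 1 - r) * invPoch q (n - 1 + r)) := by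
      intro n
      have e1 : invPoch q ((N : ℤ) - n) = (1 - q ^ ((N : ℤ) + 1 - n)) * invPoch q (N + 1 - n) := by
        rw [← invPoch_sub_one hq]; congr 1; ring
      have e2 : invPoch q ((n : ℤ) - 1 - r) = (1 - q ^ ((n : ℤ) - r)) * invPoch q (n - r) := by
        rw [← invPoch_sub_one hq]; congr 1; ring
      have e3 : invPoch q ((n : ℤ) - 1 + r) = (1 - q ^ ((n : ℤ) + r)) * invPoch q (n + r) := by
        rw [← invPoch_sub_one hq]; congr 1; ring
      have e4 : (N : ℤ) + 1 - (n + 1 : ℕ) = N - n := by push_cast; ring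
      have e5 : ((n + 1 : ℕ) : ℤ) - 1 = n := by push_cast; ring
      rw [e4, e5, e2, e3, baileyWeight_succ hq, e1]
      simp only [zpow_sub₀ hq0, zpow_add₀ hq0, zpow_natCast, zpow_one, pow_succ]
      have hn : q ^ n ≠ 0 := pow_ne_zero _ hq0
      have hr : q ^ r ≠ 0 := pow_ne_zero _ hq0
      field_simp
      ring
    have tel := sum_congr (rfl : range (N + 2) = range (N + 2)) fun n _ => key n
    rw [sum_range_sub (fun n : ℕ => -q ^ ((N : ℤ) + 1 - n) * baileyWeight q n *
      invPoch q (N + 1 - n) * invPoch q (n - 1 - r) * invPoch q (n - 1 + r)), sum_sub_distrib,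
      ← mul_sum, ← mul_sum, sum_range_succ (fun n : ℕ => baileyWeight q n * invPoch q (N - n) *
      invPoch q (n - r) * invPoch q (n + r)), ih,
      invPoch_of_neg q (show (N : ℤ) - (N + 1 : ℕ) < 0 by push_cast; omega),
      invPoch_of_neg q (show (N : ℤ) + 1 - (N + 2 : ℕ) < 0 by push_cast; omega),
      invPoch_of_neg q (show ((0 : ℕ) : ℤ) - 1 - r < 0 by push_cast; omega)] at tel
    have f1 : invPoch q ((N : ℤ) - r) = (1 - q ^ ((N : ℤ) + 1 - r)) * invPoch q (N + 1 - r) := by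
      rw [← invPoch_sub_one hq]; congr 1; ring
    have f2 : invPoch q ((N : ℤ) + r) = (1 - q ^ ((N : ℤ) + 1 + r)) * invPoch q (N + 1 + r) := by
      rw [← invPoch_sub_one hq]; congr 1; ring
    have g1 : (1 - q ^ ((N : ℤ) + 1 - r)) ≠ 0 := by
      rw [show (N : ℤ) + 1 - r = ((N - r + 1 : ℕ) : ℤ) by push_cast [hN]; ring, zpow_natCast]
      exact one_sub_pow_succ_ne_zero hq _
    have g2 : (1 - q ^ ((N : ℤ) + 1 + r)) ≠ 0 := by
      rw [show (N : ℤ) + 1 + r = ((N + r + 1 : ℕ) : ℤ) by push_cast; ring, zpow_natCast]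
      exact one_sub_pow_succ_ne_zero hq _
    rw [f1, f2] at tel
    have hM : qPoch q (-q) (N + 1) = qPoch q (-q) N * (1 + q ^ (N + 1)) := by
      rw [qPoch_succ, neg_mul, sub_neg_eq_add, ← pow_succ']
    refine mul_left_cancel₀ (mul_ne_zero g1 g2) ?_
    rw [hM]
    push_cast at tel ⊢
    linear_combination tel

/-- The terminating Bailey lemma for `a = 1` with parameters `-1`, `∞`. -/
lemma bailey_transform {q : ℂ} (hq0 : q ≠ 0) (hq : ‖q‖ < 1) {α β : ℕ → ℂ}
    (h : ∀ n : ℕ, ∑ r ∈ range (n + 1), α r * (invPoch q (n - r) * invPoch q (n + r)) = β n)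
    (N : ℕ) :
    ∑ r ∈ range (N + 1), 2 / (1 + q ^ r) * q ^ (r + 1).choose 2 * α r *
        (invPoch q (N - r) * invPoch q (N + r)) =
      (qPoch q (-q) N)⁻¹ * ∑ n ∈ range (N + 1), baileyWeight q n * β n * invPoch q (N - n) := by
  have h' : ∀ n ∈ range (N + 1), baileyWeight q n * β n * invPoch q (N - n) =
      ∑ r ∈ range (N + 1), α r * (baileyWeight q n * invPoch q (N - n) * invPoch q (n - r) *
        invPoch q (n + r)) := by
    intro n hn
    have hn := mem_range.mp hn
    rw [← h n, mul_sum, sum_mul]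
    refine (sum_congr rfl fun r _ => by ring).trans
      (sum_subset (range_subset_range.mpr (by omega)) fun r _ hr => ?_)
    rw [mem_range] at hr
    rw [invPoch_of_neg q (show (n : ℤ) - r < 0 by omega)]
    simp
  rw [sum_congr rfl h', sum_comm, mul_sum]
  refine sum_congr rfl fun r _ => ?_
  rw [← mul_sum, sum_baileyWeight hq0 hq]
  have := qPoch_neg_ne_zero hq N
  field_simp

/-- The unit Bailey pair for `a = 1`. -/
lemma sum_unit_bailey_pair {q : ℂ} (hq0 : q ≠ 0) (hq : ‖q‖ < 1) (n : ℕ) :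
    ∑ r ∈ range (n + 1), (absWeight r * (-1) ^ r * q ^ r.choose 2 * (1 + q ^ r) / 2) *
      (invPoch q (n - r) * invPoch q (n + r)) = if n = 0 then 1 else 0 := by
  rcases n with _ | n
  · simp [absWeight, invPoch_zero]
  set m : ℕ := n + 1 with hm
  have h1 : (1 - q ^ m) ≠ 0 := one_sub_pow_succ_ne_zero hq n
  have key : ∀ r : ℕ,
      (absWeight (r + 1) * (-1) ^ (r + 1) * q ^ (r + 1).choose 2 * (1 + q ^ (r + 1)) / 2) *
        (invPoch q (m - (r + 1 : ℕ)) * invPoch q (m + (r + 1 : ℕ))) =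
      ((-1) ^ (r + 1) * q ^ (r + 1 + 1).choose 2 / (1 - q ^ m) *
        (invPoch q (m - (r + 1 : ℕ)) * invPoch q (m + (r + 1 : ℕ)) *
          (1 - q ^ ((m : ℤ) - (r + 1 : ℕ))))) -
      ((-1) ^ r * q ^ (r + 1).choose 2 / (1 - q ^ m) *
        (invPoch q (m - r) * invPoch q (m + r) * (1 - q ^ ((m : ℤ) - r)))) := by
    intro r
    have e1 : invPoch q ((m : ℤ) - (r + 1 : ℕ)) = (1 - q ^ ((m : ℤ) - r)) * invPoch q (m - r) := by
      rw [← invPoch_sub_one hq]; congr 1; push_cast; ring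
    have e2 : invPoch q ((m : ℤ) + r) =
        (1 - q ^ ((m : ℤ) + (r + 1 : ℕ))) * invPoch q (m + (r + 1 : ℕ)) := by
      rw [← invPoch_sub_one hq]; congr 1; push_cast; ring
    rw [e1, e2, pow_choose_two_succ q (r + 1), absWeight, if_neg (by omega)]
    simp only [zpow_sub₀ hq0, zpow_add₀ hq0, zpow_natCast, pow_succ]
    have hr : q ^ r ≠ 0 := pow_ne_zero _ hq0
    field_simp
    ring
  rw [sum_range_succ', sum_congr rfl fun r _ => key r,
    sum_range_sub fun r : ℕ => ((-1) ^ r * q ^ (r + 1).choose 2 / (1 - q ^ m) *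
        (invPoch q (m - r) * invPoch q (m + r) * (1 - q ^ ((m : ℤ) - r))))]
  have h2 : q ^ ((n : ℤ) + 1) = q ^ (n + 1) := by exact_mod_cast zpow_natCast q (n + 1)
  rw [hm] at h1
  simp [absWeight, hm, h2]
  field_simp
  ring

/-- A Bailey pair for `a = 1` whose `α` is a Hecke-type partial theta sum. -/
lemma sum_hecke_bailey_pair {q : ℂ} (hq0 : q ≠ 0) (hq : ‖q‖ < 1) (n : ℕ) :
    ∑ r ∈ range (n + 1), (q ^ (r + 1).choose 2 * thetaInvPartial q (r + 1) -
        q ^ r.choose 2 * thetaInvPartial q r) * (invPoch q (n - r) * invPoch q (n + r)) =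
      (-1) ^ n * 2 / (q ^ n.choose 2 * (1 + q ^ n)) * invPoch q n := by
  induction n with
  | zero => simp [thetaInvPartial, absWeight, invPoch_zero]; norm_num
  | succ n ih =>
    have hT : ∀ r, thetaInvPartial q (r + 1) =
        thetaInvPartial q r + absWeight r * (-1) ^ r * (q ^ (r ^ 2))⁻¹ := fun r =>
      sum_range_succ _ _
    set α : ℕ → ℂ := fun r => q ^ (r + 1).choose 2 * thetaInvPartial q (r + 1) -
        q ^ r.choose 2 * thetaInvPartial q r with hα
    have hα' : ∀ r, q ^ (r + 1).choose 2 * thetaInvPartial q (r + 1) -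
        q ^ r.choose 2 * thetaInvPartial q r = α r := fun _ => rfl
    simp only [hα'] at ih ⊢
    set Q : ℕ → ℂ := fun r =>
      (q ^ r.choose 2 * thetaInvPartial q r * ((q ^ (n + 1) / q) * ((1 + q ^ r) -
          q ^ (n + 1) / q ^ r * (1 + q ^ r * q ^ r * q ^ r)) -
        (q ^ n * (1 - q ^ (n + 1) * q ^ (n + 1)) +
          (1 + q ^ n) * ((1 - q ^ (n + 1) / q ^ r) * (1 - q ^ (n + 1) * q ^ r)))) +
        2 * (-1) ^ r * q ^ n * (1 - q ^ (n + 1) * q ^ r) / q ^ r.choose 2) *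
        (invPoch q ((n + 1 : ℕ) - r) * invPoch q ((n + 1 : ℕ) + r)) with hQ
    have key : ∀ r : ℕ,
        q ^ n * (1 - q ^ (n + 1) * q ^ (n + 1)) *
          (α (r + 1) * (invPoch q ((n + 1 : ℕ) - (r + 1 : ℕ)) *
            invPoch q ((n + 1 : ℕ) + (r + 1 : ℕ)))) +
        (1 + q ^ n) *
          (α (r + 1) * (invPoch q (n - (r + 1 : ℕ)) * invPoch q (n + (r + 1 : ℕ)))) =
        Q (r + 1) - Q (r + 1 + 1) := by
      intro r
      set s := r + 1 with hs
      have e1 : invPoch q (((n + 1 : ℕ) : ℤ) - (s + 1 : ℕ)) =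
          (1 - q ^ (((n + 1 : ℕ) : ℤ) - s)) * invPoch q ((n + 1 : ℕ) - s) := by
        rw [← invPoch_sub_one hq]; congr 1; push_cast; ring
      have e2 : invPoch q (((n + 1 : ℕ) : ℤ) + s) =
          (1 - q ^ (((n + 1 : ℕ) : ℤ) + (s + 1 : ℕ))) * invPoch q ((n + 1 : ℕ) + (s + 1 : ℕ)) := by
        rw [← invPoch_sub_one hq]; congr 1; push_cast; ring
      have e3 : invPoch q ((n : ℤ) - s) =
          (1 - q ^ (((n + 1 : ℕ) : ℤ) - s)) * invPoch q ((n + 1 : ℕ) - s) := by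
        rw [← invPoch_sub_one hq]; congr 1; push_cast; ring
      have e4 : invPoch q ((n : ℤ) + s) =
          (1 - q ^ (((n + 1 : ℕ) : ℤ) + s)) * invPoch q ((n + 1 : ℕ) + s) := by
        rw [← invPoch_sub_one hq]; congr 1; push_cast; ring
      simp only [hα, hQ]
      rw [e4, e1, e2, e3, hT s, absWeight, if_neg (by omega), ← pow_choose_two_mul,
        pow_choose_two_succ q s]
      simp only [zpow_sub₀ hq0, zpow_add₀ hq0, zpow_natCast, pow_succ (-1 : ℂ), pow_succ q]
      have h1 : q ^ s ≠ 0 := pow_ne_zero _ hq0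
      have h2 : q ^ s.choose 2 ≠ 0 := pow_ne_zero _ hq0
      field_simp
      ring
    have tel := sum_congr (rfl : range (n + 1) = range (n + 1)) fun r _ => key r
    rw [sum_range_sub' (fun r => Q (r + 1)), sum_add_distrib, ← mul_sum, ← mul_sum] at tel
    rw [sum_range_succ'] at ih
    rw [sum_range_succ']
    rw [sum_range_succ (fun r : ℕ => α (r + 1) * (invPoch q (n - (r + 1 : ℕ)) *
      invPoch q (n + (r + 1 : ℕ)))), invPoch_of_neg q (show (n : ℤ) - (n + 1 : ℕ) < 0 by
        push_cast; omega)] at tel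
    have hQn : Q (n + 1 + 1) = 0 := by
      simp only [hQ]
      rw [invPoch_of_neg q (show ((n + 1 : ℕ) : ℤ) - (n + 1 + 1 : ℕ) < 0 by push_cast; omega)]
      simp
    have hα0 : α 0 = 1 := by simp [hα, thetaInvPartial, absWeight]
    have hI : invPoch q n = (1 - q ^ (n + 1)) * invPoch q (n + 1 : ℕ) := by
      rw [← zpow_natCast, ← invPoch_sub_one hq]; congr 1; push_cast; ring
    have hI' : invPoch q (((n + 1 : ℕ) : ℤ) + (0 + 1 : ℕ)) * (1 - q ^ (n + 1 + 1)) =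
        invPoch q (n + 1 : ℕ) := by
      rw [← zpow_natCast, mul_comm]; push_cast
      have := invPoch_sub_one hq ((n : ℤ) + 1 + 1)
      rw [add_sub_cancel_right] at this
      exact this.symm
    have hQ1 : Q (0 + 1) = - (q ^ n * (1 - q ^ (n + 1) * q ^ (n + 1)) + (1 + q ^ n) *
        ((1 - q ^ (n + 1)) * (1 - q ^ (n + 1)))) * invPoch q (n + 1 : ℕ) ^ 2 := by
      simp only [hQ]
      rw [← hI', show ((n + 1 : ℕ) : ℤ) - (0 + 1 : ℕ) = n by push_cast; ring, hI, ← hI']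
      simp [thetaInvPartial, absWeight, pow_succ]
      field_simp
      ring
    rw [hQn, hQ1] at tel
    rw [hα0] at ih ⊢
    simp only [Nat.cast_zero, sub_zero, add_zero, mul_zero, zero_mul, one_mul] at ih tel ⊢
    have h1 := one_sub_pow_succ_ne_zero hq n
    have h2 := one_add_pow_ne_zero hq (n + 1)
    have h3 := one_add_pow_ne_zero hq n
    have h4 : q ^ n ≠ 0 := pow_ne_zero _ hq0
    have h5 : q ^ n.choose 2 ≠ 0 := pow_ne_zero _ hq0
    refine mul_left_cancel₀ (mul_ne_zero h4 (mul_ne_zero h1 h2)) ?_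
    rw [pow_choose_two_succ]
    have rhs : q ^ n * ((1 - q ^ (n + 1)) * (1 + q ^ (n + 1))) *
        ((-1) ^ (n + 1) * 2 / (q ^ n.choose 2 * q ^ n * (1 + q ^ (n + 1))) *
          invPoch q (n + 1 : ℕ)) =
        -(1 + q ^ n) * ((-1) ^ n * 2 / (q ^ n.choose 2 * (1 + q ^ n)) * invPoch q n) := by
      rw [hI, pow_succ (-1 : ℂ)]
      field_simp
    rw [rhs, ← ih]
    rw [hI]
    linear_combination tel

lemma exists_tendsto_qPoch {q a : ℂ} (hq : ‖q‖ < 1) (ha : ‖a‖ < 1) :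
    ∃ L, L ≠ 0 ∧ Tendsto (qPoch q a) atTop (𝓝 L) := by
  have hs : Summable fun k : ℕ => ‖-(a * q ^ k)‖ := by
    simp only [norm_neg, norm_mul, norm_pow]
    exact (summable_geometric_of_lt_one (norm_nonneg q) hq).mul_left _
  have hm := multipliable_one_add_of_summable hs
  refine ⟨_, tprod_one_add_ne_zero_of_summable (fun k h => ?_) hs, ?_⟩
  · have h1 : ‖a * q ^ k‖ < 1 := by
      rw [norm_mul, norm_pow]
      exact mul_lt_one_of_nonneg_of_lt_one_left (norm_nonneg _) ha
        (pow_le_one₀ (norm_nonneg _) hq.le)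
    rw [← sub_eq_add_neg, sub_eq_zero] at h
    rw [← h] at h1
    simp at h1
  · have := hm.tendsto_prod_tprod_nat
    refine this.congr fun n => ?_
    simp only [qPoch, sub_eq_add_neg]

lemma exists_norm_le_of_tendsto {f : ℕ → ℂ} {L : ℂ} (h : Tendsto f atTop (𝓝 L)) :
    ∃ B, 0 ≤ B ∧ ∀ n, ‖f n‖ ≤ B := by
  obtain ⟨B, hB⟩ := h.norm.bddAbove_range
  exact ⟨B, (norm_nonneg _).trans (hB ⟨0, rfl⟩), fun n => hB ⟨n, rfl⟩⟩

lemma exists_norm_qPoch_le {q a : ℂ} (hq : ‖q‖ < 1) (ha : ‖a‖ < 1) :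
    ∃ B, 0 ≤ B ∧ ∀ n, ‖qPoch q a n‖ ≤ B :=
  let ⟨_, _, h⟩ := exists_tendsto_qPoch hq ha
  exists_norm_le_of_tendsto h

lemma exists_norm_inv_qPoch_le {q a : ℂ} (hq : ‖q‖ < 1) (ha : ‖a‖ < 1) :
    ∃ B, 0 ≤ B ∧ ∀ n, ‖(qPoch q a n)⁻¹‖ ≤ B :=
  let ⟨_, h0, h⟩ := exists_tendsto_qPoch hq ha
  exists_norm_le_of_tendsto (h.inv₀ h0)

lemma exists_norm_invPoch_le {q : ℂ} (hq : ‖q‖ < 1) : ∃ B, 0 ≤ B ∧ ∀ m, ‖invPoch q m‖ ≤ B := by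
  obtain ⟨B, hB0, hB⟩ := exists_norm_inv_qPoch_le hq hq
  refine ⟨B, hB0, fun m => ?_⟩
  unfold invPoch
  split_ifs
  · simpa using hB0
  · exact hB _

lemma norm_two_div_one_add_pow_le {q : ℂ} (hq : ‖q‖ < 1) (n : ℕ) :
    ‖2 / (1 + q ^ n)‖ ≤ 2 / (1 - ‖q‖) := by
  have h0 : 0 < 1 - ‖q‖ := by linarith
  rw [norm_div, Complex.norm_ofNat]
  refine div_le_div_of_nonneg_left (by norm_num) h0 ?_
  rcases n with _ | n
  · rw [pow_zero]; norm_num; linarith [norm_nonneg q]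
  · have h1 : ‖q ^ (n + 1)‖ ≤ ‖q‖ := by
      rw [norm_pow]; exact pow_le_of_le_one (norm_nonneg _) hq.le (by omega)
    have h2 := norm_sub_le (1 + q ^ (n + 1)) (q ^ (n + 1))
    rw [add_sub_cancel_right, norm_one] at h2
    linarith

/-- Tannery's theorem for partial sums with bounded weights tending to one. -/
lemma tendsto_sum_mul_of_bounded {f : ℕ → ℂ} (hf : Summable fun n => ‖f n‖) {a : ℕ → ℕ → ℂ} {B : ℝ}
    (hB : ∀ N n, ‖a N n‖ ≤ B) (h0 : ∀ N n, N < n → a N n = 0)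
    (h1 : ∀ n, Tendsto (fun N => a N n) atTop (𝓝 1)) :
    Tendsto (fun N => ∑ n ∈ range (N + 1), f n * a N n) atTop (𝓝 (∑' n, f n)) := by
  have h : ∀ N, ∑ n ∈ range (N + 1), f n * a N n = ∑' n, f n * a N n := fun N => by
    refine (tsum_eq_sum fun n hn => ?_).symm
    rw [mem_range] at hn
    rw [h0 N n (by omega), mul_zero]
  simp only [h]
  refine tendsto_tsum_of_dominated_convergence (hf.mul_right B) (fun n => ?_)
    (Eventually.of_forall fun N n => ?_)
  · simpa using (h1 n).const_mul (f n)
  · rw [norm_mul]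
    exact mul_le_mul_of_nonneg_left (hB N n) (norm_nonneg _)

lemma tendsto_qPoch_mul_invPoch_sub {q : ℂ} (hq : ‖q‖ < 1) (n : ℕ) :
    Tendsto (fun N : ℕ => qPoch q q N * invPoch q (N - n)) atTop (𝓝 1) := by
  obtain ⟨L, hL, h⟩ := exists_tendsto_qPoch hq hq
  have h2 := h.mul ((h.comp (tendsto_sub_atTop_nat n)).inv₀ hL)
  rw [mul_inv_cancel₀ hL] at h2
  refine h2.congr' ?_
  filter_upwards [eventually_ge_atTop n] with N hN
  rw [← Nat.cast_sub hN, invPoch_natCast]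
  rfl

lemma tendsto_qPoch_mul_invPoch_add {q : ℂ} (hq : ‖q‖ < 1) (n : ℕ) :
    Tendsto (fun N : ℕ => qPoch q q N * invPoch q (N + n)) atTop (𝓝 1) := by
  obtain ⟨L, hL, h⟩ := exists_tendsto_qPoch hq hq
  have h2 := h.mul ((h.comp (tendsto_add_atTop_nat n)).inv₀ hL)
  rw [mul_inv_cancel₀ hL] at h2
  refine h2.congr fun N => ?_
  rw [← Nat.cast_add, invPoch_natCast]
  rfl

lemma tendsto_qPoch_mul_sum {q : ℂ} (hq : ‖q‖ < 1) {f : ℕ → ℂ} (hf : Summable fun n => ‖f n‖) :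
    Tendsto (fun N : ℕ => qPoch q q N * ∑ n ∈ range (N + 1), f n * invPoch q (N - n)) atTop
      (𝓝 (∑' n, f n)) := by
  obtain ⟨B₁, h₁, hB₁⟩ := exists_norm_qPoch_le hq hq
  obtain ⟨B₂, h₂, hB₂⟩ := exists_norm_invPoch_le hq
  refine (tendsto_sum_mul_of_bounded hf (a := fun N n => qPoch q q N * invPoch q (N - n))
    (B := B₁ * B₂) (fun N n => ?_) (fun N n h => ?_) (tendsto_qPoch_mul_invPoch_sub hq)).congr
    fun N => ?_
  · rw [norm_mul]
    exact mul_le_mul (hB₁ _) (hB₂ _) (norm_nonneg _) h₁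
  · rw [invPoch_of_neg q (by omega), mul_zero]
  · rw [mul_sum]
    exact sum_congr rfl fun n _ => by ring

lemma tendsto_qPoch_sq_mul_sum {q : ℂ} (hq : ‖q‖ < 1) {f : ℕ → ℂ}
    (hf : Summable fun n => ‖f n‖) :
    Tendsto (fun N : ℕ => qPoch q q N ^ 2 *
      ∑ n ∈ range (N + 1), f n * (invPoch q (N - n) * invPoch q (N + n))) atTop
      (𝓝 (∑' n, f n)) := by
  obtain ⟨B₁, h₁, hB₁⟩ := exists_norm_qPoch_le hq hq
  obtain ⟨B₂, h₂, hB₂⟩ := exists_norm_invPoch_le hq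
  refine (tendsto_sum_mul_of_bounded hf (a := fun N n => (qPoch q q N * invPoch q (N - n)) *
    (qPoch q q N * invPoch q (N + n))) (B := (B₁ * B₂) * (B₁ * B₂)) (fun N n => ?_)
    (fun N n h => ?_) (fun n => ?_)).congr fun N => ?_
  · simp only [norm_mul]
    have := mul_le_mul (hB₁ N) (hB₂ (N - n)) (norm_nonneg _) h₁
    have := mul_le_mul (hB₁ N) (hB₂ (N + n)) (norm_nonneg _) h₁
    gcongr
  · rw [invPoch_of_neg q (by omega)]; simp
  · simpa using (tendsto_qPoch_mul_invPoch_sub hq n).mul (tendsto_qPoch_mul_invPoch_add hq n)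
  · rw [mul_sum]
    exact sum_congr rfl fun n _ => by ring

lemma norm_absWeight_le (j : ℕ) : ‖absWeight j‖ ≤ 2 := by
  unfold absWeight
  split_ifs <;> norm_num

lemma summable_norm_theta {q : ℂ} (hq : ‖q‖ < 1) :
    Summable fun r : ℕ => ‖absWeight r * (-1) ^ r * q ^ r ^ 2‖ := by
  refine Summable.of_nonneg_of_le (fun _ => norm_nonneg _) (fun r => ?_)
    ((summable_geometric_of_lt_one (norm_nonneg q) hq).mul_left 2)
  simp only [norm_mul, norm_pow, norm_neg, norm_one, one_pow, mul_one]
  exact mul_le_mul (norm_absWeight_le r)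
    (pow_le_pow_of_le_one (norm_nonneg _) hq.le (Nat.le_self_pow two_ne_zero r))
    (by positivity) (by norm_num)

/-- Gauss' product for the theta function, as a limit. -/
lemma tendsto_qPoch_div {q : ℂ} (hq0 : q ≠ 0) (hq : ‖q‖ < 1) :
    Tendsto (fun N => qPoch q q N / qPoch q (-q) N) atTop
      (𝓝 (∑' r : ℕ, absWeight r * (-1) ^ r * q ^ r ^ 2)) := by
  refine (tendsto_qPoch_sq_mul_sum hq (summable_norm_theta hq)).congr fun N => ?_
  have hb := bailey_transform hq0 hq (sum_unit_bailey_pair hq0 hq) N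
  have hs : ∑ n ∈ range (N + 1), baileyWeight q n * (if n = 0 then 1 else 0) * invPoch q (N - n) =
      (qPoch q q N)⁻¹ := by
    rw [sum_eq_single_of_mem 0 (by simp) fun n _ hn => by simp [hn], ← invPoch_natCast]
    simp [baileyWeight, qPoch]
    norm_num
  rw [hs] at hb
  have h1 := qPoch_self_ne_zero hq N
  have h2 := qPoch_neg_ne_zero hq N
  have h3 : ∀ r : ℕ, absWeight r * (-1) ^ r * q ^ r ^ 2 = 2 / (1 + q ^ r) * q ^ (r + 1).choose 2 *
      (absWeight r * (-1) ^ r * q ^ r.choose 2 * (1 + q ^ r) / 2) := fun r => by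
    have := one_add_pow_ne_zero hq r
    rw [← pow_choose_two_mul]
    field_simp
  simp only [h3, hb]
  field_simp

/-- The terms of the `q`-Gauss series `₂φ₁(-1, -1; -q^(k+1); q, -q^(k+1))`. -/
noncomputable def gaussTerm (q : ℂ) (k n : ℕ) : ℂ :=
  (2 * qPoch q (-q) n / (1 + q ^ n)) ^ 2 * (-q ^ (k + 1)) ^ n * invPoch q n *
    (qPoch q (-q) k / qPoch q (-q) (n + k))

lemma exists_norm_gaussTerm_le {q : ℂ} (hq : ‖q‖ < 1) :
    ∃ B, ∀ k n, ‖gaussTerm q k n‖ ≤ B * ‖q‖ ^ ((k + 1) * n) := by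
  have hq' : ‖-q‖ < 1 := by rwa [norm_neg]
  obtain ⟨B₁, h₁, hB₁⟩ := exists_norm_qPoch_le hq hq'
  obtain ⟨B₂, h₂, hB₂⟩ := exists_norm_invPoch_le hq
  obtain ⟨B₃, h₃, hB₃⟩ := exists_norm_inv_qPoch_le hq hq'
  have h₄ : 0 ≤ 2 / (1 - ‖q‖) := by
    have : 0 < 1 - ‖q‖ := by linarith
    positivity
  refine ⟨(2 / (1 - ‖q‖) * B₁) ^ 2 * B₂ * (B₁ * B₃), fun k n => ?_⟩
  have h₅ : gaussTerm q k n = (2 / (1 + q ^ n) * qPoch q (-q) n) ^ 2 * invPoch q n *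
      (qPoch q (-q) k * (qPoch q (-q) (n + k))⁻¹) * (-q ^ (k + 1)) ^ n := by
    unfold gaussTerm; ring
  rw [h₅]
  simp only [norm_mul, norm_pow, norm_neg]
  rw [← pow_mul]
  have := norm_two_div_one_add_pow_le hq n
  have := hB₁ n
  have := hB₁ k
  have := hB₂ n
  have := hB₃ (n + k)
  gcongr

lemma summable_norm_gaussTerm {q : ℂ} (hq : ‖q‖ < 1) (k : ℕ) :
    Summable fun n => ‖gaussTerm q k n‖ := by
  obtain ⟨B, hB⟩ := exists_norm_gaussTerm_le hq
  refine Summable.of_nonneg_of_le (fun _ => norm_nonneg _) (hB k) ?_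
  simp only [pow_mul]
  exact (summable_geometric_of_lt_one (by positivity)
    (pow_lt_one₀ (norm_nonneg _) hq (by omega))).mul_left _

lemma gaussTerm_zero_right {q : ℂ} (hq : ‖q‖ < 1) (k : ℕ) : gaussTerm q k 0 = 1 := by
  have := qPoch_neg_ne_zero hq k
  rw [gaussTerm, Nat.zero_add, div_self this]
  simp [qPoch, invPoch]
  norm_num

lemma gaussTerm_contiguous {q : ℂ} (hq : ‖q‖ < 1) (k n : ℕ) :
    (1 + q ^ (k + 1)) ^ 2 * gaussTerm q k n - (1 - q ^ (k + 1)) ^ 2 * gaussTerm q (k + 1) n =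
      (1 + q ^ (k + 1)) * (1 - q ^ n) * gaussTerm q k n -
        (1 + q ^ (k + 1)) * (1 - q ^ (n + 1)) * gaussTerm q k (n + 1) := by
  have hI : invPoch q n = (1 - q ^ (n + 1)) * invPoch q (n + 1 : ℕ) := by
    rw [← zpow_natCast, ← invPoch_sub_one hq]; congr 1; push_cast; ring
  have hS : ∀ m, qPoch q (-q) (m + 1) = qPoch q (-q) m * (1 + q ^ (m + 1)) := fun m => by
    rw [qPoch_succ, neg_mul, sub_neg_eq_add, ← pow_succ']
  have h1 := one_add_pow_ne_zero hq n
  have h2 := one_add_pow_ne_zero hq (n + 1)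
  have h3 := one_add_pow_ne_zero hq (n + k + 1)
  have h4 := qPoch_neg_ne_zero hq (n + k)
  unfold gaussTerm
  rw [hI, show n + (k + 1) = n + k + 1 by ring, show n + 1 + k = n + k + 1 by ring, hS (n + k),
    hS k, hS n]
  have e1 : (-q ^ (k + 1 + 1)) ^ n = (-q ^ (k + 1)) ^ n * q ^ n := by
    rw [← mul_pow]; ring
  rw [e1, pow_succ (-q ^ (k + 1)) n]
  field_simp
  ring

lemma tsum_gaussTerm_succ {q : ℂ} (hq : ‖q‖ < 1) (k : ℕ) :
    (1 + q ^ (k + 1)) ^ 2 * ∑' n, gaussTerm q k n =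
      (1 - q ^ (k + 1)) ^ 2 * ∑' n, gaussTerm q (k + 1) n := by
  have s1 := (summable_norm_gaussTerm hq k).of_norm
  have s2 := (summable_norm_gaussTerm hq (k + 1)).of_norm
  have h := ((s1.hasSum.mul_left ((1 + q ^ (k + 1)) ^ 2)).sub
    (s2.hasSum.mul_left ((1 - q ^ (k + 1)) ^ 2))).tendsto_sum_nat
  simp only [gaussTerm_contiguous hq] at h
  have h' : Tendsto (fun n => (1 + q ^ (k + 1)) * (1 - q ^ n) * gaussTerm q k n) atTop (𝓝 0) := by
    have := (((tendsto_pow_atTop_nhds_zero_of_norm_lt_one hq).const_sub 1).const_mul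
      (1 + q ^ (k + 1))).mul s1.tendsto_atTop_zero
    rwa [mul_zero] at this
  simp only [sum_range_sub' fun n => (1 + q ^ (k + 1)) * (1 - q ^ n) * gaussTerm q k n] at h
  have h2 := h'.const_sub ((1 + q ^ (k + 1)) * (1 - q ^ 0) * gaussTerm q k 0)
  have h3 := tendsto_nhds_unique h h2
  rw [pow_zero] at h3
  linear_combination h3

/-- A case of the `q`-Gauss sum. -/
lemma tsum_gaussTerm {q : ℂ} (hq0 : q ≠ 0) (hq : ‖q‖ < 1) :
    ∑' n, gaussTerm q 0 n = (∑' r : ℕ, absWeight r * (-1) ^ r * q ^ r ^ 2) ^ 2 := by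
  have h : ∀ k, ∑' n, gaussTerm q 0 n =
      (qPoch q q k / qPoch q (-q) k) ^ 2 * ∑' n, gaussTerm q k n := by
    intro k
    induction k with
    | zero => simp [qPoch]
    | succ k ih =>
      have h1 := tsum_gaussTerm_succ hq k
      have h2 := one_add_pow_ne_zero hq (k + 1)
      have h3 := qPoch_neg_ne_zero hq k
      rw [ih, qPoch_succ, qPoch_succ, neg_mul, sub_neg_eq_add, ← pow_succ']
      field_simp
      linear_combination qPoch q q k ^ 2 * h1
  have h1 : Tendsto (fun k => ∑' n, gaussTerm q k n) atTop (𝓝 (∑' n : ℕ, if n = 0 then 1 else 0)) := by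
    obtain ⟨B, hB⟩ := exists_norm_gaussTerm_le hq
    have hB0 : 0 ≤ B := by simpa using (norm_nonneg _).trans (hB 0 0)
    refine tendsto_tsum_of_dominated_convergence
      ((summable_geometric_of_lt_one (norm_nonneg q) hq).mul_left B) (fun n => ?_)
      (Eventually.of_forall fun k n => (hB k n).trans ?_)
    · rcases n with _ | n
      · simp [gaussTerm_zero_right hq]
      · refine squeeze_zero_norm (a := fun k => B * ‖q‖ ^ k) (fun k => (hB k _).trans ?_) ?_
        · refine mul_le_mul_of_nonneg_left ?_ hB0
          exact pow_le_pow_of_le_one (norm_nonneg _) hq.le (by nlinarith)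
        · simpa using (tendsto_pow_atTop_nhds_zero_of_lt_one (norm_nonneg q) hq).const_mul B
    · refine mul_le_mul_of_nonneg_left ?_ hB0
      exact pow_le_pow_of_le_one (norm_nonneg _) hq.le (by nlinarith)
  rw [tsum_ite_eq] at h1
  have h2 := ((tendsto_qPoch_div hq0 hq).pow 2).mul h1
  simp only [← h, mul_one] at h2
  exact tendsto_nhds_unique tendsto_const_nhds h2

/-- The `r`-th term of the Hecke-type series for the cube of the theta function. -/
noncomputable def heckeTerm (q : ℂ) (r : ℕ) : ℂ :=
  2 / (1 + q ^ r) * q ^ (r + 1).choose 2 * (q ^ (r + 1).choose 2 * thetaInvPartial q (r + 1) -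
    q ^ r.choose 2 * thetaInvPartial q r)

lemma norm_pow_sq_mul_thetaInvPartial_le {q : ℂ} (hq0 : q ≠ 0) (hq : ‖q‖ < 1) (r : ℕ) :
    ‖q ^ r ^ 2 * thetaInvPartial q r‖ ≤ 2 * r * ‖q‖ ^ r := by
  unfold thetaInvPartial
  rw [mul_sum]
  refine (norm_sum_le_of_le (range r) (f := fun j => q ^ r ^ 2 *
    (absWeight j * (-1) ^ j * (q ^ j ^ 2)⁻¹)) (n := fun _ => 2 * ‖q‖ ^ r) fun j hj => ?_).trans ?_
  · have hj := mem_range.mp hj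
    have hle : j ^ 2 + r ≤ r ^ 2 := by nlinarith
    have e : q ^ r ^ 2 * (absWeight j * (-1) ^ j * (q ^ j ^ 2)⁻¹) =
        absWeight j * (-1) ^ j * q ^ (r ^ 2 - j ^ 2) := by
      rw [← pow_sub_mul_pow q (show j ^ 2 ≤ r ^ 2 by omega)]
      have := pow_ne_zero (j ^ 2) hq0
      field_simp
    rw [e]
    simp only [norm_mul, norm_pow, norm_neg, norm_one, one_pow, mul_one]
    exact mul_le_mul (norm_absWeight_le j)
      (pow_le_pow_of_le_one (norm_nonneg _) hq.le (by omega)) (by positivity) (by norm_num)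
  · rw [sum_const, card_range, nsmul_eq_mul]
    apply le_of_eq; ring

lemma heckeTerm_eq {q : ℂ} (hq0 : q ≠ 0) (r : ℕ) :
    heckeTerm q r = 2 / (1 + q ^ r) * (absWeight r * (-1) ^ r * q ^ r -
      (1 - q ^ r) * (q ^ r ^ 2 * thetaInvPartial q r)) := by
  have h : thetaInvPartial q (r + 1) =
      thetaInvPartial q r + absWeight r * (-1) ^ r * (q ^ r ^ 2)⁻¹ := sum_range_succ _ _
  have h1 : q ^ r ≠ 0 := pow_ne_zero _ hq0
  have h2 : q ^ r.choose 2 ≠ 0 := pow_ne_zero _ hq0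
  rw [heckeTerm, h, ← pow_choose_two_mul, pow_choose_two_succ]
  field_simp
  ring

lemma summable_norm_heckeTerm {q : ℂ} (hq0 : q ≠ 0) (hq : ‖q‖ < 1) :
    Summable fun r => ‖heckeTerm q r‖ := by
  have hs : Summable fun r : ℕ => 2 / (1 - ‖q‖) * (2 * ‖q‖ ^ r + 4 * (r * ‖q‖ ^ r)) := by
    have h1 := summable_geometric_of_lt_one (norm_nonneg q) hq
    have h2 := summable_pow_mul_geometric_of_norm_lt_one 1 (r := ‖q‖) (by simpa using hq)
    simp only [pow_one] at h2
    exact ((h1.mul_left 2).add (h2.mul_left 4)).mul_left _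
  refine Summable.of_nonneg_of_le (fun _ => norm_nonneg _) (fun r => ?_) hs
  rw [heckeTerm_eq hq0, norm_mul]
  have h0 : 0 < 1 - ‖q‖ := by linarith
  refine mul_le_mul (norm_two_div_one_add_pow_le hq r) ?_ (norm_nonneg _) (by positivity)
  refine (norm_sub_le _ _).trans (add_le_add ?_ ?_)
  · simp only [norm_mul, norm_pow, norm_neg, norm_one, one_pow, mul_one]
    exact mul_le_mul_of_nonneg_right (norm_absWeight_le r) (by positivity)
  · rw [norm_mul]
    have h1 : ‖1 - q ^ r‖ ≤ 2 := by
      refine (norm_sub_le _ _).trans ?_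
      rw [norm_one, norm_pow]
      linarith [pow_le_one₀ (n := r) (norm_nonneg q) hq.le]
    have h2 := norm_pow_sq_mul_thetaInvPartial_le hq0 hq r
    calc _ ≤ 2 * (2 * r * ‖q‖ ^ r) := mul_le_mul h1 h2 (norm_nonneg _) (by norm_num)
      _ = _ := by ring

lemma theta_cube_eq_tsum_heckeTerm {q : ℂ} (hq0 : q ≠ 0) (hq : ‖q‖ < 1) :
    (∑' r : ℕ, absWeight r * (-1) ^ r * q ^ r ^ 2) ^ 3 = ∑' r, heckeTerm q r := by
  have h1 := tendsto_qPoch_sq_mul_sum hq (summable_norm_heckeTerm hq0 hq)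
  have h2 := (tendsto_qPoch_div hq0 hq).mul (tendsto_qPoch_mul_sum hq (summable_norm_gaussTerm hq 0))
  rw [tsum_gaussTerm hq0 hq] at h2
  rw [pow_succ']
  refine tendsto_nhds_unique (h2.congr fun N => ?_) h1
  have hb := bailey_transform hq0 hq (sum_hecke_bailey_pair hq0 hq) N
  unfold heckeTerm
  rw [hb]
  have hg : ∀ n : ℕ, gaussTerm q 0 n = baileyWeight q n *
      ((-1) ^ n * 2 / (q ^ n.choose 2 * (1 + q ^ n)) * invPoch q n) := fun n => by
    have h1 := one_add_pow_ne_zero hq n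
    have h2 := qPoch_neg_ne_zero hq n
    have h3 : q ^ n.choose 2 ≠ 0 := pow_ne_zero _ hq0
    rw [gaussTerm, baileyWeight, pow_choose_two_succ, zero_add, pow_one, add_zero, neg_pow]
    simp only [qPoch, range_zero, prod_empty]
    simp only [← qPoch.eq_1]
    field_simp
  simp only [hg]
  ring

lemma sum_Ioo_neg_of_even {h : ℤ → ℂ} (hh : ∀ j, h (-j) = h j) (r : ℕ) :
    ∑ j ∈ Ioo (-(r : ℤ)) r, h j = ∑ j ∈ range r, absWeight j * h j := by
  induction r with
  | zero => simp
  | succ r ih =>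
    rw [sum_range_succ, ← ih]
    rcases r with _ | r
    · have : Ioo (-((0 + 1 : ℕ) : ℤ)) ((0 + 1 : ℕ) : ℤ) = {0} := by decide
      rw [this]; simp [absWeight]
    · have : Ioo (-((r + 1 + 1 : ℕ) : ℤ)) ((r + 1 + 1 : ℕ) : ℤ) =
          insert ((r + 1 : ℕ) : ℤ) (insert (-((r + 1 : ℕ) : ℤ))
            (Ioo (-((r + 1 : ℕ) : ℤ)) ((r + 1 : ℕ) : ℤ))) := by
        ext j; simp only [mem_Ioo, mem_insert]; omega
      rw [this, sum_insert (by simp only [mem_Ioo, mem_insert]; omega), sum_insert (by simp), hh,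
        absWeight, if_neg (by omega)]
      ring

lemma sum_Ioo_eq_thetaInvPartial {q : ℂ} (hq0 : q ≠ 0) (r : ℕ) :
    ∑ j ∈ Ioo (-(r : ℤ)) r, (-1 : ℂ) ^ j * q ^ ((r : ℤ) ^ 2 - j ^ 2) =
      q ^ r ^ 2 * thetaInvPartial q r := by
  rw [sum_Ioo_neg_of_even (h := fun j => (-1 : ℂ) ^ j * q ^ ((r : ℤ) ^ 2 - j ^ 2)) fun j => by
    simp [zpow_neg, ← inv_zpow], thetaInvPartial, mul_sum]
  refine sum_congr rfl fun j _ => ?_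
  rw [zpow_sub₀ hq0, zpow_natCast]
  norm_cast
  ring

lemma tsum_int_theta {q : ℂ} (hq : ‖q‖ < 1) :
    ∑' n : ℤ, (-1 : ℂ) ^ n * q ^ (n ^ 2) = ∑' r : ℕ, absWeight r * (-1) ^ r * q ^ r ^ 2 := by
  have e : ∀ n : ℕ, (-1 : ℂ) ^ (n : ℤ) * q ^ ((n : ℤ) ^ 2) = (-1) ^ n * q ^ n ^ 2 := fun n => by
    norm_cast
  have e' : ∀ n : ℕ, (-1 : ℂ) ^ (-(n : ℤ)) * q ^ ((-(n : ℤ)) ^ 2) = (-1) ^ n * q ^ n ^ 2 :=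
    fun n => by rw [neg_sq, ← e n, zpow_neg, ← inv_zpow, inv_neg_one]
  have hs : Summable fun n : ℕ => (-1 : ℂ) ^ n * q ^ n ^ 2 := by
    refine Summable.of_norm_bounded (summable_geometric_of_lt_one (norm_nonneg q) hq) fun n => ?_
    simp only [norm_mul, norm_pow, norm_neg, norm_one, one_pow, one_mul]
    exact pow_le_pow_of_le_one (norm_nonneg _) hq.le (Nat.le_self_pow two_ne_zero n)
  rw [Summable.tsum_of_nat_of_neg (by simpa only [e] using hs) (by simpa only [e'] using hs)]
  simp only [e, e']
  rw [hs.tsum_eq_zero_add, (summable_norm_theta hq).of_norm.tsum_eq_zero_add]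
  simp only [absWeight, Nat.add_eq_zero_iff, one_ne_zero, and_false, if_false, if_true, mul_assoc,
    tsum_mul_left]
  simp
  ring

theorem andrews_three_squares
    (q : ℂ) (hq0 : 0 < ‖q‖) (hq1 : ‖q‖ < 1) :
    (∑' n : ℤ, (-1 : ℂ) ^ n * q ^ (n ^ 2)) ^ 3 =
      1 + 4 * (∑' n : ℕ, (-1 : ℂ) ^ (n + 1) * q ^ (n + 1) / (1 + q ^ (n + 1))) -
        2 * ∑' n : ℕ,
          (1 - q ^ (n + 1)) / (1 + q ^ (n + 1)) *
            ∑ j ∈ Finset.Ioo (-((n : ℤ) + 1)) ((n : ℤ) + 1),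
              (-1 : ℂ) ^ j * q ^ (((n : ℤ) + 1) ^ 2 - j ^ 2) := by
  have hq : q ≠ 0 := norm_pos_iff.mp hq0
  have hL : Summable fun n : ℕ => (-1 : ℂ) ^ (n + 1) * q ^ (n + 1) / (1 + q ^ (n + 1)) := by
    refine Summable.of_norm_bounded
      ((summable_geometric_of_lt_one (norm_nonneg q) hq1).mul_left (2 / (1 - ‖q‖))) fun n => ?_
    have h0 : 0 < 1 - ‖q‖ := by linarith
    have e : (-1 : ℂ) ^ (n + 1) * q ^ (n + 1) / (1 + q ^ (n + 1)) =
        2 / (1 + q ^ (n + 1)) * ((-1) ^ (n + 1) / 2 * q ^ (n + 1)) := by ring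
    rw [e, norm_mul]
    refine mul_le_mul (norm_two_div_one_add_pow_le hq1 _) ?_ (norm_nonneg _) (by positivity)
    rw [norm_mul, norm_div, norm_pow, norm_neg, norm_one, one_pow, norm_pow, Complex.norm_ofNat]
    have h2 := pow_le_pow_of_le_one (norm_nonneg q) hq1.le (Nat.le_succ n)
    have h3 : 0 ≤ ‖q‖ ^ (n + 1) := by positivity
    rw [Nat.succ_eq_add_one] at h2
    linarith
  have hH := (summable_norm_heckeTerm hq hq1).of_norm
  have hH' := (summable_nat_add_iff 1).mpr hH
  have hD : ∀ n : ℕ, (1 - q ^ (n + 1)) / (1 + q ^ (n + 1)) *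
      ∑ j ∈ Finset.Ioo (-((n : ℤ) + 1)) ((n : ℤ) + 1),
        (-1 : ℂ) ^ j * q ^ (((n : ℤ) + 1) ^ 2 - j ^ 2) =
      2 * ((-1 : ℂ) ^ (n + 1) * q ^ (n + 1) / (1 + q ^ (n + 1))) - 1 / 2 * heckeTerm q (n + 1) := by
    intro n
    have h1 := sum_Ioo_eq_thetaInvPartial hq (n + 1)
    push_cast at h1
    rw [h1, heckeTerm_eq hq, absWeight, if_neg (by omega)]
    ring
  have h0 : heckeTerm q 0 = 1 := by simp [heckeTerm, thetaInvPartial, absWeight]; norm_num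
  rw [tsum_int_theta hq1, theta_cube_eq_tsum_heckeTerm hq hq1, hH.tsum_eq_zero_add, h0,
    tsum_congr hD, (hL.mul_left 2).tsum_sub (hH'.mul_left (1 / 2)), tsum_mul_left, tsum_mul_left]
  ring
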